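/- arXiv:1805.08377 — 11 statements merged into one kernel-verified Lean document; each statement's English description precedes it below -/
import Mathlib

section
/- Let f : ℝ → ℝ be a positive function that is nonincreasing on (-∞, 0] and nondecreasing on [0, ∞). Let n ≥ 0, let x_0 ≤ x_1 ≤ … ≤ x_n be real numbers, and for each i = 1, …, n let y_i ∈ [x_{i-1}, x_i]. Then f(x_0) + f(x_1) + … + f(x_n) > f(y_1) + … + f(y_n). -/
/-- Strengthening of the squeezing inequality suited to induction: when all points are
nonpositive, the last summand `f (x n)` can be dropped. -/
lemma interval_squeezing_aux
    {f : ℝ → ℝ} (hpos : ∀ x, 0 < f x)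
    (hanti : AntitoneOn f (Set.Iic 0)) (hmono : MonotoneOn f (Set.Ici 0))
    (n : ℕ) {x y : ℕ → ℝ}
    (hy : ∀ i, 1 ≤ i → i ≤ n → y i ∈ Set.Icc (x (i - 1)) (x i)) :
    ∑ i ∈ Finset.Icc 1 n, f (y i) < ∑ i ∈ Finset.range (n + 1), f (x i) ∧
      (x n ≤ 0 → ∑ i ∈ Finset.Icc 1 n, f (y i) ≤ ∑ i ∈ Finset.range n, f (x i)) := by
  induction n with
  | zero => simp [hpos]
  | succ n ih =>
    obtain ⟨ih_lt, ih_le⟩ := ih fun i h₁ h₂ => hy i h₁ (by omega)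
    obtain ⟨hl, hr⟩ : x n ≤ y (n + 1) ∧ y (n + 1) ≤ x (n + 1) :=
      hy (n + 1) (by omega) le_rfl
    have left_bound (h : y (n + 1) ≤ 0) :
        ∑ i ∈ Finset.Icc 1 (n + 1), f (y i) ≤ ∑ i ∈ Finset.range (n + 1), f (x i) := by
      rw [Finset.sum_Icc_succ_top (by omega), Finset.sum_range_succ]
      exact add_le_add (ih_le (hl.trans h)) (hanti (hl.trans h) h hl)
    refine ⟨?_, fun h => left_bound (hr.trans h)⟩
    rw [Finset.sum_range_succ]
    rcases le_total (y (n + 1)) 0 with h | h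
    · exact (left_bound h).trans_lt (lt_add_of_pos_right _ (hpos _))
    · rw [Finset.sum_Icc_succ_top (by omega)]
      exact add_lt_add_of_lt_of_le ih_lt (hmono h (h.trans hr) hr)


/-- Interval Squeezing Lemma: for a positive density that is nonincreasing on
`(-∞, 0]` and nondecreasing on `[0, ∞)`, if `x₀ ≤ x₁ ≤ … ≤ xₙ` and
`yᵢ ∈ [xᵢ₋₁, xᵢ]`, then `f x₀ + … + f xₙ > f y₁ + … + f yₙ`. -/
theorem interval_squeezing
    (f : ℝ → ℝ) (hpos : ∀ x, 0 < f x)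
    (hanti : AntitoneOn f (Set.Iic 0)) (hmono : MonotoneOn f (Set.Ici 0))
    (n : ℕ) (x : ℕ → ℝ) (hx : ∀ i, i < n → x i ≤ x (i + 1))
    (y : ℕ → ℝ) (hy : ∀ i, 1 ≤ i → i ≤ n → y i ∈ Set.Icc (x (i - 1)) (x i)) :
    ∑ i ∈ Finset.range (n + 1), f (x i) > ∑ i ∈ Finset.Icc 1 n, f (y i) := by
  exact (interval_squeezing_aux hpos hanti hmono n hy).1
end

section
/- Let g : ℝ → ℝ be a continuous, strictly increasing, odd function (g(-v) = -g(v) for all v). Let n ≥ 1 and let V_1, …, V_n be positive real numbers with S = V_1 + … + V_n. Then there exists exactly one W ∈ [-S, 0] such that g(W) + g(W + V_1) + g(W + V_1 + V_2) + … + g(W + V_1 + … + V_n) = 0. -/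
/-- A sum of translates of a strictly monotone function over a nonempty index set is strictly
monotone. -/
theorem StrictMono.sum_translates {ι : Type*} {g : ℝ → ℝ} (hg : StrictMono g) {s : Finset ι}
    (hs : s.Nonempty) (c : ι → ℝ) : StrictMono fun x => ∑ i ∈ s, g (x + c i) :=
  fun _ _ hxy => Finset.sum_lt_sum_of_nonempty hs fun _ _ => hg (by linarith)

/-- Existence and uniqueness of the standard `n`-bubble: for a continuous,
strictly increasing, odd function `g` and positive volumes `V 0, …, V (n-1)`
with sum `S`, there is exactly one `W ∈ [-S, 0]` with
`g W + g (W + V 0) + g (W + V 0 + V 1) + … + g (W + V 0 + … + V (n-1)) = 0`. -/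
theorem standard_bubble_exists_unique
    (g : ℝ → ℝ) (hcont : Continuous g) (hmono : StrictMono g)
    (hodd : ∀ v : ℝ, g (-v) = -g v)
    (n : ℕ) (hn : 1 ≤ n) (V : ℕ → ℝ) (hV : ∀ i, i < n → 0 < V i)
    (S : ℝ) (hS : S = ∑ i ∈ Finset.range n, V i) :
    ∃! W : ℝ, W ∈ Set.Icc (-S) 0 ∧
      ∑ i ∈ Finset.range (n + 1), g (W + ∑ j ∈ Finset.range i, V j) = 0 := by
  have hg0 : g 0 = 0 := by
    have h := hodd 0
    rw [neg_zero] at h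
    linarith
  have hVnonneg : ∀ i ∈ Finset.range n, 0 ≤ V i := fun i hi => (hV i (Finset.mem_range.1 hi)).le
  have hpartial_nonneg : ∀ i ∈ Finset.range (n + 1), 0 ≤ ∑ j ∈ Finset.range i, V j :=
    fun i hi => Finset.sum_nonneg fun j hj =>
      hVnonneg j (by rw [Finset.mem_range] at *; omega)
  have hpartial_le : ∀ i ∈ Finset.range (n + 1), ∑ j ∈ Finset.range i, V j ≤ S := by
    intro i hi
    rw [hS]
    refine Finset.sum_le_sum_of_subset_of_nonneg ?_ fun j hj _ => hVnonneg j hj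
    exact Finset.range_subset_range.2 (by rw [Finset.mem_range] at hi; omega)
  have hS0 : 0 ≤ S := hS ▸ Finset.sum_nonneg hVnonneg
  set F : ℝ → ℝ := fun W => ∑ i ∈ Finset.range (n + 1), g (W + ∑ j ∈ Finset.range i, V j)
  have hFmono : StrictMono F := hmono.sum_translates Finset.nonempty_range_add_one _
  have hFcont : Continuous F := by fun_prop
  have hF_neg : F (-S) ≤ 0 := Finset.sum_nonpos fun i hi => by
    rw [← hg0]
    exact hmono.monotone (by linarith [hpartial_le i hi])
  have hF_zero : 0 ≤ F 0 := Finset.sum_nonneg fun i hi => by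
    rw [← hg0]
    exact hmono.monotone (by linarith [hpartial_nonneg i hi])
  obtain ⟨W, hW, hFW⟩ :=
    intermediate_value_Icc (neg_nonpos.2 hS0) hFcont.continuousOn ⟨hF_neg, hF_zero⟩
  exact ⟨W, ⟨hW, hFW⟩, fun y hy => hFmono.injective (hy.2.trans hFW.symm)⟩
end

section
/- Let g : ℝ → ℝ be a continuous, strictly increasing, odd function (g(-v) = -g(v) for all v), and let 0 < V_1 ≤ V_2 ≤ V_3. Suppose W ∈ [-(V_1+V_2+V_3), 0] satisfies g(W) + g(W + V_2) + g(W + V_2 + V_1 + V_3) = 0. Then the two inequalities W + V_2 < -V_1/2 and W + V_2 + V_1 + V_3 > V_1/2 hold simultaneously if and only if g(V_3 + V_1/2) > g(V_2 + V_1/2) + g(V_1/2). -/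
/-- Existence criterion for an equilibrium of type 2313: the inner single
bubble `[-V₁/2, V₁/2]` is strictly nested in the second component of the outer
standard double bubble if and only if `g (V₃ + V₁/2) > g (V₂ + V₁/2) + g (V₁/2)`. -/
theorem type2313_exists_iff
    (g : ℝ → ℝ) (hcont : Continuous g) (hmono : StrictMono g)
    (hodd : ∀ v : ℝ, g (-v) = -g v)
    (V₁ V₂ V₃ : ℝ) (hV₁ : 0 < V₁) (h12 : V₁ ≤ V₂) (h23 : V₂ ≤ V₃)
    (W : ℝ) (hW : W ∈ Set.Icc (-(V₁ + V₂ + V₃)) 0)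
    (heq : g W + g (W + V₂) + g (W + V₂ + V₁ + V₃) = 0) :
    (W + V₂ < -(V₁ / 2) ∧ W + V₂ + V₁ + V₃ > V₁ / 2) ↔
      g (V₃ + V₁ / 2) > g (V₂ + V₁ / 2) + g (V₁ / 2) := by
  have hF : StrictMono fun w => g w + g (w + V₂) + g (w + V₂ + V₁ + V₃) := by
    intro a b hab
    have h₁ := hmono hab
    have h₂ : g (a + V₂) < g (b + V₂) := hmono (by linarith)
    have h₃ : g (a + V₂ + V₁ + V₃) < g (b + V₂ + V₁ + V₃) := hmono (by linarith)
    simp only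
    linarith
  have hleft : W < -(V₂ + V₁ / 2) ↔ g (V₃ + V₁ / 2) > g (V₂ + V₁ / 2) + g (V₁ / 2) := by
    rw [← hF.lt_iff_lt]
    simp only [heq]
    rw [show -(V₂ + V₁ / 2) + V₂ = -(V₁ / 2) by ring,
      show -(V₁ / 2) + V₁ + V₃ = V₃ + V₁ / 2 by ring, hodd, hodd]
    constructor <;> intro h <;> linarith
  have hright : -(V₂ + V₃ + V₁ / 2) < W := by
    rw [← hF.lt_iff_lt]
    simp only [heq]
    rw [show -(V₂ + V₃ + V₁ / 2) + V₂ = -(V₃ + V₁ / 2) by ring,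
      show -(V₃ + V₁ / 2) + V₁ + V₃ = V₁ / 2 by ring, hodd (V₃ + V₁ / 2)]
    have h₁ : g (V₁ / 2) < g (V₃ + V₁ / 2) := hmono (by linarith)
    have h₂ : g (-(V₂ + V₃ + V₁ / 2)) < g 0 := hmono (by linarith)
    have h₃ := hodd 0
    rw [neg_zero] at h₃
    linarith
  rw [← hleft]
  constructor
  · rintro ⟨h, -⟩
    linarith
  · intro h
    constructor <;> linarith
end

section
/- Let g : ℝ → ℝ be a continuous, strictly increasing, odd function (g(-v) = -g(v) for all v), let 0 < V_1 ≤ V_2 ≤ V_3, and set S = V_1 + V_2 + V_3. If W satisfies g(W) + g(W + V_1) + g(W + V_1 + V_2) = 0, then -S/2 < W and W + V_1 + V_2 < S/2. -/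
/-- The standard double bubble with volumes `V₁, V₂` is strictly nested inside
the standard single bubble `[-S/2, S/2]` with `S = V₁ + V₂ + V₃`, so an
equilibrium of type 3123 always exists. -/
theorem type3123_nested
    (g : ℝ → ℝ) (hcont : Continuous g) (hmono : StrictMono g)
    (hodd : ∀ v : ℝ, g (-v) = -g v)
    (V₁ V₂ V₃ : ℝ) (hV₁ : 0 < V₁) (h12 : V₁ ≤ V₂) (h23 : V₂ ≤ V₃)
    (S : ℝ) (hS : S = V₁ + V₂ + V₃)
    (W : ℝ) (heq : g W + g (W + V₁) + g (W + V₁ + V₂) = 0) :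
    -(S / 2) < W ∧ W + V₁ + V₂ < S / 2 := by
  constructor
  · by_contra! h
    have hW : g W < g (-W) := hmono (by linarith)
    have hbc : g (W + V₁) ≤ g (-(W + V₁ + V₂)) := hmono.monotone (by linarith)
    rw [hodd] at hW hbc
    linarith
  · by_contra! h
    have hc : g (-(W + V₁ + V₂)) < g (W + V₁ + V₂) := hmono (by linarith)
    have hab : g (-(W + V₁)) ≤ g W := hmono.monotone (by linarith)
    rw [hodd] at hc hab
    linarith
end

section
/- Let f : ℝ → ℝ be a positive continuous function that is nonincreasing on (-∞, 0] and nondecreasing on [0, ∞). Let x_0 < x_1 < x_2 < x_3 be real numbers with ∫_{x_0}^{x_1} f + ∫_{x_2}^{x_3} f ≤ ∫_{x_1}^{x_2} f. Then there exists y ∈ [x_1, x_2] such that ∫_{x_0}^{y} f = ∫_{x_0}^{x_1} f + ∫_{x_2}^{x_3} f and f(y) < f(x_1) + f(x_2). -/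
/-- Rearrangement showing a double bubble `|R₁ˡ|R₂|R₁ʳ|` with `V₁ ≤ V₂` is not
perimeter minimizing: there is `y ∈ [x₁, x₂]` making `|R₁|R₂|` with the same
volumes and strictly smaller perimeter. -/
theorem double_bubble_121_not_min
    (f : ℝ → ℝ) (hpos : ∀ x, 0 < f x) (hcont : Continuous f)
    (hanti : AntitoneOn f (Set.Iic 0)) (hmono : MonotoneOn f (Set.Ici 0))
    (x₀ x₁ x₂ x₃ : ℝ) (h01 : x₀ < x₁) (h12 : x₁ < x₂) (h23 : x₂ < x₃)
    (hvol : (∫ t in x₀..x₁, f t) + ∫ t in x₂..x₃, f t ≤ ∫ t in x₁..x₂, f t) :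
    ∃ y ∈ Set.Icc x₁ x₂,
      (∫ t in x₀..y, f t) = (∫ t in x₀..x₁, f t) + (∫ t in x₂..x₃, f t) ∧
      f y < f x₁ + f x₂ := by
  have hint : ∀ a b, IntervalIntegrable f MeasureTheory.volume a b :=
    fun a b => hcont.intervalIntegrable a b
  have hprim : Continuous fun y => ∫ t in x₀..y, f t :=
    intervalIntegral.continuous_primitive hint x₀
  have hleft : 0 ≤ ∫ t in x₀..x₁, f t :=
    intervalIntegral.integral_nonneg h01.le fun t _ => (hpos t).le
  have hright : 0 ≤ ∫ t in x₂..x₃, f t :=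
    intervalIntegral.integral_nonneg h23.le fun t _ => (hpos t).le
  have hadd := intervalIntegral.integral_add_adjacent_intervals (hint x₀ x₁) (hint x₁ x₂)
  obtain ⟨y, hy, hyvol⟩ := intermediate_value_Icc h12.le hprim.continuousOn
    (show (∫ t in x₀..x₁, f t) + (∫ t in x₂..x₃, f t) ∈
      Set.Icc (∫ t in x₀..x₁, f t) (∫ t in x₀..x₂, f t) from
        ⟨by linarith, by linarith⟩)
  refine ⟨y, hy, hyvol, ?_⟩
  rcases le_total y 0 with h | h
  · linarith [hanti (hy.1.trans h) h hy.1, hpos x₂]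
  · linarith [hmono h (h.trans hy.2) hy.2, hpos x₁]
end

section
/- Let f : ℝ → ℝ be a positive continuous function that is nonincreasing on (-∞, 0] and nondecreasing on [0, ∞). Let x_0 < x_1 < x_2 < x_3 < x_4 be real numbers, and set V_1 = ∫_{x_0}^{x_1} f + ∫_{x_3}^{x_4} f, V_2 = ∫_{x_1}^{x_2} f, V_3 = ∫_{x_2}^{x_3} f. Assume V_1 ≤ V_2 and V_1 ≤ V_3. Then there exist y_1 ∈ [x_1, x_2] and y_2 ∈ [x_2, x_3] with y_1 ≤ y_2 such that ∫_{x_0}^{y_1} f = V_2, ∫_{y_1}^{y_2} f = V_1, ∫_{y_2}^{x_4} f = V_3, and f(y_1) + f(y_2) < f(x_1) + f(x_2) + f(x_3). -/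
/-- Rearrangement showing a triple bubble `|R₁ˡ|R₂|R₃|R₁ʳ|` with `V₁ ≤ V₂` and
`V₁ ≤ V₃` is not perimeter minimizing: the configuration `|R₂|R₁|R₃|` with the
same volumes and same outer endpoints has strictly smaller perimeter. -/
theorem triple_bubble_1231_not_min
    (f : ℝ → ℝ) (hpos : ∀ x, 0 < f x) (hcont : Continuous f)
    (hanti : AntitoneOn f (Set.Iic 0)) (hmono : MonotoneOn f (Set.Ici 0))
    (x₀ x₁ x₂ x₃ x₄ : ℝ)
    (h01 : x₀ < x₁) (h12 : x₁ < x₂) (h23 : x₂ < x₃) (h34 : x₃ < x₄)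
    (V₁ V₂ V₃ : ℝ)
    (hV₁ : V₁ = (∫ t in x₀..x₁, f t) + ∫ t in x₃..x₄, f t)
    (hV₂ : V₂ = ∫ t in x₁..x₂, f t)
    (hV₃ : V₃ = ∫ t in x₂..x₃, f t)
    (h12' : V₁ ≤ V₂) (h13' : V₁ ≤ V₃) :
    ∃ y₁ ∈ Set.Icc x₁ x₂, ∃ y₂ ∈ Set.Icc x₂ x₃, y₁ ≤ y₂ ∧
      (∫ t in x₀..y₁, f t) = V₂ ∧ (∫ t in y₁..y₂, f t) = V₁ ∧
      (∫ t in y₂..x₄, f t) = V₃ ∧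
      f y₁ + f y₂ < f x₁ + f x₂ + f x₃ := by
  have hi : ∀ a b, IntervalIntegrable f MeasureTheory.volume a b :=
    fun a b => hcont.intervalIntegrable a b
  have hadd : ∀ a b c, (∫ t in a..b, f t) + (∫ t in b..c, f t) = ∫ t in a..c, f t :=
    fun a b c => intervalIntegral.integral_add_adjacent_intervals (hi a b) (hi b c)
  have hnonneg : ∀ a b, a ≤ b → 0 ≤ ∫ t in a..b, f t :=
    fun a b hab => intervalIntegral.integral_nonneg hab fun t _ => (hpos t).le
  have hF : Continuous fun y => ∫ t in x₀..y, f t :=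
    intervalIntegral.continuous_primitive hi x₀
  have h_left := hnonneg x₀ x₁ h01.le
  have h_right := hnonneg x₃ x₄ h34.le
  have e₂ := hadd x₀ x₁ x₂
  have e₃ := hadd x₀ x₂ x₃
  have e₄ := hadd x₀ x₃ x₄
  obtain ⟨y₁, hy₁, hI₁⟩ := intermediate_value_Icc h12.le hF.continuousOn
    (show V₂ ∈ Set.Icc _ _ from ⟨by linarith, by linarith⟩)
  obtain ⟨y₂, hy₂, hI₂⟩ := intermediate_value_Icc h23.le hF.continuousOn
    (show V₂ + V₁ ∈ Set.Icc _ _ from ⟨by linarith, by linarith⟩)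
  simp only at hI₁ hI₂
  have e₁₂ := hadd x₀ y₁ y₂
  have e₂₄ := hadd x₀ y₂ x₄
  refine ⟨y₁, hy₁, y₂, hy₂, hy₁.2.trans hy₂.1, hI₁, by linarith, by linarith, ?_⟩
  have hmax : ∀ a b y, y ∈ Set.Icc a b → f y < f a + f b := by
    rintro a b y ⟨hay, hyb⟩
    have hfa := hpos a
    have hfb := hpos b
    rcases le_total y 0 with hy | hy
    · linarith [hanti (Set.mem_Iic.2 (hay.trans hy)) (Set.mem_Iic.2 hy) hay]
    · linarith [hmono (Set.mem_Ici.2 hy) (Set.mem_Ici.2 (hy.trans hyb)) hyb]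
  rcases le_total x₂ 0 with h | h
  · linarith [hmax x₂ x₃ y₂ hy₂, hanti (Set.mem_Iic.2 (h12.le.trans h))
      (Set.mem_Iic.2 (hy₁.2.trans h)) hy₁.1]
  · linarith [hmax x₁ x₂ y₁ hy₁, hmono (Set.mem_Ici.2 (h.trans hy₂.1))
      (Set.mem_Ici.2 (h.trans h23.le)) hy₂.2]
end

section
/- Let f : ℝ → ℝ be a positive continuous function that is nonincreasing on (-∞, 0] and nondecreasing on [0, ∞). Let x_0 < x_1 < x_2 < x_3 < x_4 be real numbers, and set V_b = ∫_{x_1}^{x_2} f + ∫_{x_3}^{x_4} f and V_c = ∫_{x_2}^{x_3} f. Assume V_b ≤ V_c. Then there exists y ∈ [x_2, x_3] such that ∫_{x_1}^{y} f = V_b, ∫_{y}^{x_4} f = V_c, and f(y) < f(x_2) + f(x_3). -/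
/-- A function that is antitone on `(-∞, 0]` and monotone on `[0, ∞)` is bounded on an interval
by the larger of its values at the endpoints. -/
theorem le_max_of_antitoneOn_monotoneOn {f : ℝ → ℝ} (hanti : AntitoneOn f (Set.Iic 0))
    (hmono : MonotoneOn f (Set.Ici 0)) {a b y : ℝ} (hy : y ∈ Set.Icc a b) :
    f y ≤ max (f a) (f b) := by
  rcases le_total y 0 with h | h
  · exact le_max_of_le_left (hanti (hy.1.trans h) h hy.1)
  · exact le_max_of_le_right (hmono h (h.trans hy.2) hy.2)

/-- Rearrangement showing a triple bubble `|Rₐ|R_bˡ|R_c|R_bʳ|` with `V_b ≤ V_c`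
is not perimeter minimizing: switching `R_c` and `R_bʳ` yields `|Rₐ|R_b|R_c|`
with the same volumes and strictly smaller perimeter. -/
theorem triple_bubble_abcb_not_min
    (f : ℝ → ℝ) (hpos : ∀ x, 0 < f x) (hcont : Continuous f)
    (hanti : AntitoneOn f (Set.Iic 0)) (hmono : MonotoneOn f (Set.Ici 0))
    (x₀ x₁ x₂ x₃ x₄ : ℝ)
    (h01 : x₀ < x₁) (h12 : x₁ < x₂) (h23 : x₂ < x₃) (h34 : x₃ < x₄)
    (Vb Vc : ℝ)
    (hVb : Vb = (∫ t in x₁..x₂, f t) + ∫ t in x₃..x₄, f t)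
    (hVc : Vc = ∫ t in x₂..x₃, f t)
    (hbc : Vb ≤ Vc) :
    ∃ y ∈ Set.Icc x₂ x₃,
      (∫ t in x₁..y, f t) = Vb ∧ (∫ t in y..x₄, f t) = Vc ∧
      f y < f x₂ + f x₃ := by
  have hi (a b : ℝ) : IntervalIntegrable f MeasureTheory.volume a b :=
    hcont.intervalIntegrable a b
  have h₁ : 0 ≤ ∫ t in x₁..x₂, f t :=
    intervalIntegral.integral_nonneg h12.le fun t _ => (hpos t).le
  have h₃ : 0 ≤ ∫ t in x₃..x₄, f t :=
    intervalIntegral.integral_nonneg h34.le fun t _ => (hpos t).le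
  obtain ⟨y, hy, hyv⟩ := intermediate_value_Icc h23.le
    (intervalIntegral.continuous_primitive hi x₂).continuousOn
    (show (∫ t in x₃..x₄, f t) ∈ Set.Icc (∫ t in x₂..x₂, f t) (∫ t in x₂..x₃, f t) by
      rw [intervalIntegral.integral_same]
      exact ⟨h₃, by linarith⟩)
  beta_reduce at hyv
  refine ⟨y, hy, ?_, ?_, ?_⟩
  · rw [← intervalIntegral.integral_add_adjacent_intervals (hi x₁ x₂) (hi x₂ y), hyv, hVb]
  · have := intervalIntegral.integral_add_adjacent_intervals (hi x₂ y) (hi y x₃)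
    have := intervalIntegral.integral_add_adjacent_intervals (hi y x₃) (hi x₃ x₄)
    linarith
  · exact (le_max_of_antitoneOn_monotoneOn hanti hmono hy).trans_lt
      (max_lt (lt_add_of_pos_right _ (hpos x₃)) (lt_add_of_pos_left _ (hpos x₂)))
end

section
/- Let f : ℝ → ℝ be a positive continuous function that is nonincreasing on (-∞, 0] and nondecreasing on [0, ∞). Let x_0 < x_1 < x_2 < x_3 < x_4 < x_5 be real numbers, and set V_1 = ∫_{x_0}^{x_1} f + ∫_{x_4}^{x_5} f, V_2 = ∫_{x_2}^{x_3} f, V_3 = ∫_{x_1}^{x_2} f + ∫_{x_3}^{x_4} f. Assume V_1 ≤ V_2 and ∫_{x_0}^{x_1} f ≤ ∫_{x_3}^{x_4} f. Then there exist z_1 ∈ [x_1, x_3] and z_2 ∈ [x_3, x_4] such that ∫_{x_0}^{z_1} f = V_2, ∫_{z_1}^{z_2} f = V_3, ∫_{z_2}^{x_5} f = V_1, and f(z_1) + f(z_2) < f(x_1) + f(x_2) + f(x_3) + f(x_4). -/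
/-- Rearrangement showing a triple bubble `|R₁ˡ|R₃ˡ|R₂|R₃ʳ|R₁ʳ|` with `V₁ ≤ V₂`
and `V₁ˡ ≤ V₃ʳ` is not perimeter minimizing: the configuration `|R₂|R₃|R₁|`
with the same volumes and the same outermost boundary points has strictly
smaller perimeter. -/
theorem triple_bubble_13231_not_min
    (f : ℝ → ℝ) (hpos : ∀ x, 0 < f x) (hcont : Continuous f)
    (hanti : AntitoneOn f (Set.Iic 0)) (hmono : MonotoneOn f (Set.Ici 0))
    (x₀ x₁ x₂ x₃ x₄ x₅ : ℝ)
    (h01 : x₀ < x₁) (h12 : x₁ < x₂) (h23 : x₂ < x₃) (h34 : x₃ < x₄) (h45 : x₄ < x₅)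
    (V₁ V₂ V₃ : ℝ)
    (hV₁ : V₁ = (∫ t in x₀..x₁, f t) + ∫ t in x₄..x₅, f t)
    (hV₂ : V₂ = ∫ t in x₂..x₃, f t)
    (hV₃ : V₃ = (∫ t in x₁..x₂, f t) + ∫ t in x₃..x₄, f t)
    (h12' : V₁ ≤ V₂)
    (hlr : (∫ t in x₀..x₁, f t) ≤ ∫ t in x₃..x₄, f t) :
    ∃ z₁ ∈ Set.Icc x₁ x₃, ∃ z₂ ∈ Set.Icc x₃ x₄,
      (∫ t in x₀..z₁, f t) = V₂ ∧ (∫ t in z₁..z₂, f t) = V₃ ∧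
      (∫ t in z₂..x₅, f t) = V₁ ∧
      f z₁ + f z₂ < f x₁ + f x₂ + f x₃ + f x₄ := by
  have hfi : ∀ a b, IntervalIntegrable f MeasureTheory.volume a b :=
    fun a b => hcont.intervalIntegrable a b
  have hadd : ∀ a b c, (∫ t in a..b, f t) + ∫ t in b..c, f t = ∫ t in a..c, f t :=
    fun a b c => intervalIntegral.integral_add_adjacent_intervals (hfi a b) (hfi b c)
  have hvol : ∀ a b, a < b → 0 < ∫ t in a..b, f t := fun a b hab =>
    intervalIntegral.intervalIntegral_pos_of_pos (hfi a b) hpos hab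
  have hprim : Continuous fun x => ∫ t in x₀..x, f t :=
    intervalIntegral.continuous_primitive hfi x₀
  have p01 := hvol _ _ h01
  have p12 := hvol _ _ h12
  have p45 := hvol _ _ h45
  have a02 := hadd x₀ x₁ x₂
  have a03 := hadd x₀ x₂ x₃
  have a04 := hadd x₀ x₃ x₄
  have a05 := hadd x₀ x₄ x₅
  obtain ⟨z₁, hz₁, e₁ : (∫ t in x₀..z₁, f t) = V₂⟩ :=
    intermediate_value_Icc (h12.trans h23).le hprim.continuousOn
      (show V₂ ∈ Set.Icc (∫ t in x₀..x₁, f t) (∫ t in x₀..x₃, f t) by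
        constructor <;> linarith)
  obtain ⟨z₂, hz₂, e₂ : (∫ t in x₀..z₂, f t) = V₂ + V₃⟩ :=
    intermediate_value_Icc h34.le hprim.continuousOn
      (show V₂ + V₃ ∈ Set.Icc (∫ t in x₀..x₃, f t) (∫ t in x₀..x₄, f t) by
        constructor <;> linarith)
  have b₁ := hadd x₀ z₁ z₂
  have b₂ := hadd x₀ z₂ x₅
  refine ⟨z₁, hz₁, z₂, hz₂, e₁, by linarith, by linarith, ?_⟩
  have q₁ := hpos x₁
  have q₂ := hpos x₂
  have q₃ := hpos x₃
  have q₄ := hpos x₄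
  obtain ⟨l₁, u₁⟩ := hz₁
  obtain ⟨l₂, u₂⟩ := hz₂
  rcases le_total z₁ 0 with h | h
  · have k₁ : f z₁ ≤ f x₁ := hanti (Set.mem_Iic.2 (l₁.trans h)) h l₁
    rcases le_total z₂ 0 with h' | h'
    · have k₂ : f z₂ ≤ f x₃ := hanti (Set.mem_Iic.2 (l₂.trans h')) h' l₂
      linarith
    · have k₂ : f z₂ ≤ f x₄ := hmono h' (Set.mem_Ici.2 (h'.trans u₂)) u₂
      linarith
  · have h₃ : 0 ≤ x₃ := h.trans u₁
    have k₁ : f z₁ ≤ f x₃ := hmono h h₃ u₁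
    have k₂ : f z₂ ≤ f x₄ :=
      hmono (Set.mem_Ici.2 (h₃.trans l₂)) (Set.mem_Ici.2 (h₃.trans h34.le)) u₂
    linarith
end

section
/- Let f : ℝ → ℝ be a positive continuous function that is strictly decreasing on (-∞, 0] and strictly increasing on [0, ∞). Let x_0 < x_1 < x_2 < x_3 < x_4 < x_5 be real numbers with x_2 ≤ 0 ≤ x_3, and suppose ∫_{x_0}^{x_1} f + ∫_{x_4}^{x_5} f < ∫_{x_1}^{x_2} f + ∫_{x_3}^{x_4} f. Then there exist y_1 ∈ (x_1, x_2) and y_2 ∈ (x_3, x_4) such that ∫_{y_1}^{x_2} f + ∫_{x_3}^{y_2} f = ∫_{x_0}^{x_1} f + ∫_{x_4}^{x_5} f and f(y_1) + f(y_2) < f(x_1) + f(x_4). -/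
/-- Rearrangement showing a triple bubble `|R₂ˡ|R₃ˡ|R₁|R₃ʳ|R₂ʳ|` with `V₂ < V₃`
and `0 ∈ R₁` is not perimeter minimizing: swapping bubbles 2 and 3 yields a
configuration with the same volumes and strictly smaller perimeter. -/
theorem triple_bubble_23132_not_min
    (f : ℝ → ℝ) (hpos : ∀ x, 0 < f x) (hcont : Continuous f)
    (hanti : StrictAntiOn f (Set.Iic 0)) (hmono : StrictMonoOn f (Set.Ici 0))
    (x₀ x₁ x₂ x₃ x₄ x₅ : ℝ)
    (h01 : x₀ < x₁) (h12 : x₁ < x₂) (h23 : x₂ < x₃) (h34 : x₃ < x₄) (h45 : x₄ < x₅)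
    (hx₂ : x₂ ≤ 0) (hx₃ : 0 ≤ x₃)
    (hvol : (∫ t in x₀..x₁, f t) + ∫ t in x₄..x₅, f t
        < (∫ t in x₁..x₂, f t) + ∫ t in x₃..x₄, f t) :
    ∃ y₁ ∈ Set.Ioo x₁ x₂, ∃ y₂ ∈ Set.Ioo x₃ x₄,
      (∫ t in y₁..x₂, f t) + (∫ t in x₃..y₂, f t)
        = (∫ t in x₀..x₁, f t) + (∫ t in x₄..x₅, f t) ∧
      f y₁ + f y₂ < f x₁ + f x₄ := by
  have hint : ∀ a b, IntervalIntegrable f MeasureTheory.volume a b :=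
    fun a b => hcont.intervalIntegrable a b
  have hprim : ∀ a, Continuous fun y => ∫ t in a..y, f t :=
    fun a => intervalIntegral.continuous_primitive hint a
  have hV₁ : 0 < ∫ t in x₀..x₁, f t :=
    intervalIntegral.intervalIntegral_pos_of_pos (hint _ _) hpos h01
  have hV₂ : 0 < ∫ t in x₄..x₅, f t :=
    intervalIntegral.intervalIntegral_pos_of_pos (hint _ _) hpos h45
  let G : ℝ → ℝ := fun s =>
    (∫ t in (x₂ - s * (x₂ - x₁))..x₂, f t) + ∫ t in x₃..(x₃ + s * (x₄ - x₃)), f t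
  have hG : Continuous G := by
    refine Continuous.add ?_ ((hprim x₃).comp (by fun_prop))
    exact ((hprim x₂).comp (by fun_prop : Continuous fun s : ℝ => x₂ - s * (x₂ - x₁))).neg.congr
      fun s => (intervalIntegral.integral_symm x₂ (x₂ - s * (x₂ - x₁))).symm
  have hG0 : G 0 = 0 := by simp [G]
  have hG1 : G 1 = (∫ t in x₁..x₂, f t) + ∫ t in x₃..x₄, f t := by simp [G]
  obtain ⟨s, ⟨hs0, hs1⟩, hs⟩ := intermediate_value_Ioo zero_le_one hG.continuousOn
    (⟨by linarith, by linarith⟩ :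
      (∫ t in x₀..x₁, f t) + (∫ t in x₄..x₅, f t) ∈ Set.Ioo (G 0) (G 1))
  have hy₁ : x₂ - s * (x₂ - x₁) ∈ Set.Ioo x₁ x₂ := by constructor <;> nlinarith
  have hy₂ : x₃ + s * (x₄ - x₃) ∈ Set.Ioo x₃ x₄ := by constructor <;> nlinarith
  refine ⟨_, hy₁, _, hy₂, hs, add_lt_add ?_ ?_⟩
  · exact hanti (h12.le.trans hx₂) (hy₁.2.le.trans hx₂) hy₁.1
  · exact hmono (hx₃.trans hy₂.1.le) (hx₃.trans h34.le) hy₂.2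
end

section
/- Let f : ℝ → ℝ be a convex even function (f(-v) = f(v) for all v) such that f′_R(v) < 0 for every v < 0, where f′_R(v) denotes the right derivative of f at v (the derivative of f at v within (v, ∞)). If w_1 < 0 and f′_R(w_0) + f′_R(w_1) + f′_R(w_4) ≥ 0, then w_0 + w_4 ≥ 0. -/
/-- For a convex even function with negative right derivative at every negative
point, if `w₁ < 0` and the equilibrium condition
`f′_R(w₀) + f′_R(w₁) + f′_R(w₄) ≥ 0` holds, then `w₀ + w₄ ≥ 0`. -/
theorem rightDeriv_equilibrium
    (f : ℝ → ℝ) (hconv : ConvexOn ℝ Set.univ f)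
    (heven : ∀ v : ℝ, f (-v) = f v)
    (hneg : ∀ v : ℝ, v < 0 → derivWithin f (Set.Ioi v) v < 0)
    (w₀ w₁ w₄ : ℝ) (hw₁ : w₁ < 0)
    (h : 0 ≤ derivWithin f (Set.Ioi w₀) w₀ + derivWithin f (Set.Ioi w₁) w₁
        + derivWithin f (Set.Ioi w₄) w₄) :
    0 ≤ w₀ + w₄ := by
  by_contra! hlt
  have h₀ := hconv.rightDeriv_le_slope_of_mem_interior (x := w₀) (y := -w₄)
    (by simp) (by simp) (by linarith)
  have h₄ := hconv.rightDeriv_le_slope_of_mem_interior (x := w₄) (y := -w₀)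
    (by simp) (by simp) (by linarith)
  have hslope : slope f w₄ (-w₀) = -slope f w₀ (-w₄) := by
    simp only [slope_def_field, heven]
    ring
  linarith [hneg w₁ hw₁]
end

section
/- Let f : ℝ → ℝ be a convex even function (f(-v) = f(v) for all v), and let w_0, w_1, w_2, w_3 be real numbers with w_1 + w_2 > 0 and w_0 + w_3 > 0 and f′_L(w_0) + f′_L(w_1) + f′_L(w_2) + f′_L(w_3) ≤ 0, where f′_L(v) denotes the left derivative of f at v (the derivative of f at v within (-∞, v)). Then f′_L(w_1) + f′_L(w_2) = 0 and f′_L(w_0) + f′_L(w_3) = 0. -/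
theorem Function.Even.derivWithin_Iio_eq_neg_derivWithin_Ioi {f : ℝ → ℝ} (hf : Function.Even f)
    (x : ℝ) : derivWithin f (Set.Iio x) x = -derivWithin f (Set.Ioi (-x)) (-x) := by
  have hcomp : (fun v => f (-v)) = f := funext hf
  have h := derivWithin_comp_neg (f := f) (s := Set.Iio x) (x := x)
  rwa [hcomp, Set.neg_Iio] at h

theorem ConvexOn.leftDeriv_add_leftDeriv_nonneg_of_even {f : ℝ → ℝ}
    (hconv : ConvexOn ℝ Set.univ f) (heven : Function.Even f) {a b : ℝ} (hab : 0 < a + b) :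
    0 ≤ derivWithin f (Set.Iio a) a + derivWithin f (Set.Iio b) b := by
  have hlt : -a < b := by linarith
  have hright : derivWithin f (Set.Ioi (-a)) (-a) ≤ slope f (-a) b :=
    hconv.rightDeriv_le_slope_of_mem_interior (by simp) (Set.mem_univ b) hlt
  have hleft : slope f (-a) b ≤ derivWithin f (Set.Iio b) b :=
    hconv.slope_le_leftDeriv_of_mem_interior (Set.mem_univ (-a)) (by simp) hlt
  rw [heven.derivWithin_Iio_eq_neg_derivWithin_Ioi a]
  linarith


/-- For a convex even function, if `w₁ + w₂ > 0`, `w₀ + w₃ > 0` and the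
equilibrium condition `f′_L(w₀) + f′_L(w₁) + f′_L(w₂) + f′_L(w₃) ≤ 0` holds,
then `f′_L(w₁) + f′_L(w₂) = 0` and `f′_L(w₀) + f′_L(w₃) = 0`. -/
theorem leftDeriv_equilibrium
    (f : ℝ → ℝ) (hconv : ConvexOn ℝ Set.univ f)
    (heven : ∀ v : ℝ, f (-v) = f v)
    (w₀ w₁ w₂ w₃ : ℝ) (h12 : 0 < w₁ + w₂) (h03 : 0 < w₀ + w₃)
    (h : derivWithin f (Set.Iio w₀) w₀ + derivWithin f (Set.Iio w₁) w₁
        + derivWithin f (Set.Iio w₂) w₂ + derivWithin f (Set.Iio w₃) w₃ ≤ 0) :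
    derivWithin f (Set.Iio w₁) w₁ + derivWithin f (Set.Iio w₂) w₂ = 0 ∧
    derivWithin f (Set.Iio w₀) w₀ + derivWithin f (Set.Iio w₃) w₃ = 0 := by
  have hsum12 := hconv.leftDeriv_add_leftDeriv_nonneg_of_even heven h12
  have hsum03 := hconv.leftDeriv_add_leftDeriv_nonneg_of_even heven h03
  constructor <;> linarith
end
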